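/- Let a, b, c be pairwise coprime positive integers. Then the Dedekind–Rademacher sums satisfy the reciprocity law D(a; b, c) + D(b; c, a) + D(c; a, b) = (a² + b² + c²)/(3abc) − 1. -/

import Mathlib

open Real Finset

/-- The Dedekind–Rademacher sum
`D(a; b, c) = (1/a) · Σ_{k=1}^{a−1} cot(πbk/a) · cot(πck/a)`. -/
noncomputable def dedekindRademacherSum (a : ℕ) (b c : ℤ) : ℝ :=
  (1 / (a : ℝ)) * ∑ k ∈ Finset.Ico 1 a,
    Real.cot (Real.pi * b * k / a) * Real.cot (Real.pi * c * k / a)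

theorem cot_neg_aux (x : ℝ) : Real.cot (-x) = -Real.cot x := by
  simp [Real.cot_eq_cos_div_sin, div_neg]

theorem cot_add_pi_aux (x : ℝ) : Real.cot (x + π) = Real.cot x := by
  simp [Real.cot_eq_cos_div_sin]

theorem cot_add_int_aux (x : ℝ) (n : ℤ) : Real.cot (x + n * π) = Real.cot x := by
  have : Function.Periodic Real.cot π := cot_add_pi_aux
  exact this.int_mul n x

theorem cot_three_aux (x y z : ℝ) (h : x + y + z = 0) (hx : Real.sin x ≠ 0)
    (hy : Real.sin y ≠ 0) (hz : Real.sin z ≠ 0) :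
    Real.cot x * Real.cot y + Real.cot y * Real.cot z + Real.cot z * Real.cot x = 1 := by
  have e : z = -(x + y) := by linarith
  subst e
  rw [Real.sin_neg, neg_ne_zero] at hz
  simp only [Real.cot_eq_cos_div_sin, Real.sin_neg, Real.cos_neg]
  field_simp
  rw [Real.sin_add, Real.cos_add]
  ring

theorem shift_aux (a : ℕ) (f : ℤ → ℝ) (hf : ∀ n, f (n + a) = f n) (m : ℤ) :
    ∑ i ∈ range a, f (i + m) = ∑ i ∈ range a, f i := by
  have step : ∀ m : ℤ, ∑ i ∈ range a, f (i + (m + 1)) = ∑ i ∈ range a, f (i + m) := by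
    intro m
    have h1 := Finset.sum_range_succ (fun i : ℕ => f (i + m)) a
    have h2 := Finset.sum_range_succ' (fun i : ℕ => f (i + m)) a
    rw [h1] at h2
    have h3 : f ((a : ℤ) + m) = f m := by rw [add_comm, hf]
    simp only [h3, Nat.cast_add, Nat.cast_one, Nat.cast_zero, zero_add] at h2
    have h4 : ∑ i ∈ range a, f (i + (m + 1)) = ∑ i ∈ range a, f ((i : ℤ) + 1 + m) :=
      Finset.sum_congr rfl fun i _ => by congr 1; ring
    linarith
  induction m using Int.induction_on with
  | zero => simp
  | succ k ih => rw [step, ih]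
  | pred k ih => rw [← ih, ← step]; simp

theorem sum_odd_aux (a : ℕ) (f : ℤ → ℝ) (hf : ∀ n, f (n + a) = f n)
    (ho : ∀ n, f (-n) = - f n) : ∑ i ∈ range a, f i = 0 := by
  have h1 := Finset.sum_range_reflect (fun i : ℕ => f i) a
  have h2 := shift_aux a f hf 1
  have h3 : ∑ j ∈ range a, f ((a - 1 - j : ℕ) : ℤ) = ∑ j ∈ range a, - f ((j : ℤ) + 1) := by
    refine Finset.sum_congr rfl fun j hj => ?_
    rw [mem_range] at hj
    rw [← ho, ← hf (-_)]
    congr 1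
    omega
  rw [h3, Finset.sum_neg_distrib, h2] at h1
  linarith

theorem sum_cot_int (a : ℕ) (ha : 0 < a) (m : ℤ) :
    ∑ i ∈ range a, Real.cot (π * m / a + π * i / a) = 0 := by
  have ha' : (a : ℝ) ≠ 0 := by positivity
  have hf : ∀ n : ℤ, Real.cot (π * ((n + a : ℤ) : ℝ) / a) = Real.cot (π * n / a) := by
    intro n
    rw [← cot_add_pi_aux (π * n / a)]
    congr 1
    push_cast
    field_simp
  have h1 := shift_aux a (fun n => Real.cot (π * n / a)) hf m
  have h2 := sum_odd_aux a (fun n => Real.cot (π * n / a)) hf (fun n => by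
    rw [← cot_neg_aux]; congr 1; push_cast; ring)
  rw [← h2, ← h1]
  refine Finset.sum_congr rfl fun i _ => ?_
  congr 1
  push_cast
  ring

theorem root_sum_aux (a : ℕ) (ha : 0 < a) (w : ℂ) (hw : IsPrimitiveRoot w a) (y : ℂ)
    (hy : y ^ a ≠ 1) : ∑ k ∈ range a, 1 / (y * w ^ k - 1) = a / (y ^ a - 1) := by
  have hy' : y ^ a - 1 ≠ 0 := sub_ne_zero.mpr hy
  have h1 : ∀ k ∈ range a, 1 / (y * w ^ k - 1) =
      (∑ m ∈ range a, y ^ m * (w ^ m) ^ k) / (y ^ a - 1) := by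
    intro k _
    have hp : (y * w ^ k) ^ a = y ^ a := by
      rw [mul_pow, ← pow_mul, mul_comm k a, pow_mul, hw.pow_eq_one, one_pow, mul_one]
    have hne : y * w ^ k - 1 ≠ 0 := by
      intro h
      rw [sub_eq_zero.mp h, one_pow] at hp
      exact hy hp.symm
    have hg := geom_sum_mul (y * w ^ k) a
    rw [hp] at hg
    rw [div_eq_div_iff hne hy', one_mul, ← hg]
    congr 1
    refine Finset.sum_congr rfl fun m _ => ?_
    rw [mul_pow, ← pow_mul, ← pow_mul, mul_comm k m]
  rw [Finset.sum_congr rfl h1, ← Finset.sum_div, Finset.sum_comm]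
  congr 1
  simp_rw [← Finset.mul_sum]
  rw [Finset.sum_eq_single_of_mem 0 (by simpa using ha)]
  · simp
  · intro m hm h0
    rw [mem_range] at hm
    have h1 : w ^ m ≠ 1 := hw.pow_ne_one_of_pos_of_lt h0 hm
    have h2 := geom_sum_mul (w ^ m) a
    rw [← pow_mul, mul_comm m a, pow_mul, hw.pow_eq_one, one_pow, sub_self] at h2
    rcases mul_eq_zero.mp h2 with h | h
    · rw [h, mul_zero]
    · exact absurd (sub_eq_zero.mp h) h1

theorem exp_ne_one_aux (x : ℝ) (h : Real.sin x ≠ 0) :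
    Complex.exp (2 * Complex.I * x) ≠ 1 := by
  intro h1
  apply h
  rw [Complex.exp_eq_one_iff] at h1
  obtain ⟨n, hn⟩ := h1
  have : (x : ℂ) = ((n * π : ℝ) : ℂ) := by
    have h2 : (2 * Complex.I) ≠ 0 := by simp
    apply mul_left_cancel₀ h2
    rw [hn]; push_cast; ring
  rw [Complex.ofReal_inj.mp this]
  exact Real.sin_int_mul_pi n

theorem cot_exp_aux (x : ℝ) (h : Real.sin x ≠ 0) :
    ((Real.cot x : ℝ) : ℂ) = Complex.I + 2 * Complex.I * (1 / (Complex.exp (2 * Complex.I * x) - 1)) := by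
  have h1 := sub_ne_zero.mpr (exp_ne_one_aux x h)
  have h2 : Complex.sin x ≠ 0 := by
    rw [← Complex.ofReal_sin]; exact_mod_cast h
  rw [Real.cot_eq_cos_div_sin]
  push_cast
  have e1 : Complex.exp (2 * Complex.I * x) =
      (Complex.cos x + Complex.sin x * Complex.I) ^ 2 := by
    rw [← Complex.exp_mul_I, ← Complex.exp_nat_mul]
    congr 1
    push_cast
    ring
  rw [e1] at h1 ⊢
  have h5 := Complex.sin_sq_add_cos_sq (x : ℂ)
  rw [div_eq_iff h2]
  field_simp
  have hI := Complex.I_sq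
  generalize Complex.sin (x : ℂ) = s at *
  generalize Complex.cos (x : ℂ) = c at *
  have hc : c ^ 2 = 1 - s ^ 2 := by linear_combination h5
  grind

theorem sum_cot_aux (a : ℕ) (ha : 0 < a) (x : ℝ) :
    ∑ i ∈ range a, Real.cot (x + π * i / a) = a * Real.cot (a * x) := by
  have ha' : (a : ℝ) ≠ 0 := by positivity
  have haC : (a : ℂ) ≠ 0 := by exact_mod_cast ha'
  by_cases h : Real.sin (a * x) = 0
  · rw [Real.cot_eq_cos_div_sin, h, div_zero, mul_zero]
    obtain ⟨n, hn⟩ := Real.sin_eq_zero_iff.mp h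
    rw [← sum_cot_int a ha n]
    refine Finset.sum_congr rfl fun i _ => ?_
    congr 2
    field_simp
    linarith
  · have hs : ∀ i : ℕ, Real.sin (x + π * i / a) ≠ 0 := by
      intro i hi
      obtain ⟨n, hn⟩ := Real.sin_eq_zero_iff.mp hi
      apply h
      have : a * x = ((n * a - i : ℤ) : ℝ) * π := by
        push_cast
        have : x = n * π - π * i / a := by linarith
        rw [this]; field_simp
      rw [this]
      exact Real.sin_int_mul_pi _
    have hw := Complex.isPrimitiveRoot_exp a ha.ne'
    have hpow : Complex.exp (2 * Complex.I * x) ^ a =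
        Complex.exp (2 * Complex.I * ((a * x : ℝ) : ℂ)) := by
      rw [← Complex.exp_nat_mul]; congr 1; push_cast; ring
    have key := root_sum_aux a ha _ hw (Complex.exp (2 * Complex.I * x)) (by
      rw [hpow]; exact exp_ne_one_aux _ h)
    rw [hpow] at key
    apply Complex.ofReal_injective
    push_cast
    have hc := cot_exp_aux _ h
    push_cast at hc key
    rw [hc]
    have hsum : ∀ i ∈ range a, Complex.cot (x + π * i / a) = Complex.I + 2 * Complex.I *
        (1 / (Complex.exp (2 * Complex.I * x) * Complex.exp (2 * π * Complex.I / a) ^ i - 1)) := by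
      intro i _
      have := cot_exp_aux _ (hs i)
      push_cast at this
      rw [this]
      congr 4
      rw [← Complex.exp_nat_mul, ← Complex.exp_add]
      congr 1
      ring
    rw [Finset.sum_congr rfl hsum, Finset.sum_add_distrib, ← Finset.mul_sum, key]
    simp
    ring

theorem sin_ne_aux (a b i j : ℕ) (hab : Nat.Coprime a b) (hi : i < a) (hj : j < b)
    (h : ¬ (i = 0 ∧ j = 0)) : Real.sin (π * i / a - π * j / b) ≠ 0 := by
  intro h0
  obtain ⟨n, hn⟩ := Real.sin_eq_zero_iff.mp h0
  have ha : (0 : ℝ) < a := by exact_mod_cast (by omega : 0 < a)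
  have hb : (0 : ℝ) < b := by exact_mod_cast (by omega : 0 < b)
  have h1 : (n : ℝ) * (a * b) = i * b - j * a := by
    apply mul_left_cancel₀ Real.pi_ne_zero
    have : π * (n * (a * b)) = (n * π) * (a * b) := by ring
    rw [this, hn]; field_simp
  have h2 : n * ((a : ℤ) * b) = i * b - j * a := by exact_mod_cast h1
  have h3 : (a : ℤ) ∣ i * b := ⟨n * b + j, by linear_combination -h2⟩
  have h4 : (b : ℤ) ∣ j * a := ⟨i - n * a, by linear_combination h2⟩
  have h5 : a ∣ i := hab.dvd_of_dvd_mul_right (by exact_mod_cast h3)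
  have h6 : b ∣ j := hab.symm.dvd_of_dvd_mul_right (by exact_mod_cast h4)
  exact h ⟨Nat.eq_zero_of_dvd_of_lt h5 hi, Nat.eq_zero_of_dvd_of_lt h6 hj⟩

theorem sin_ne_aux2 (a i j : ℕ) (hi : i < a) (hj : j < a)
    (h : i ≠ j) : Real.sin (π * i / a - π * j / a) ≠ 0 := by
  intro h0
  obtain ⟨n, hn⟩ := Real.sin_eq_zero_iff.mp h0
  have ha : (0 : ℝ) < a := by exact_mod_cast (by omega : 0 < a)
  have h1 : (n : ℝ) * a = i - j := by
    apply mul_left_cancel₀ Real.pi_ne_zero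
    have : π * (n * a) = (n * π) * a := by ring
    rw [this, hn]; field_simp
  have h2 : n * (a : ℤ) = i - j := by exact_mod_cast h1
  have h3 : (a : ℤ) ∣ i - j := ⟨n, by linear_combination -h2⟩
  have := Int.eq_zero_of_abs_lt_dvd h3 (by rw [abs_lt]; omega)
  omega

theorem cot_zero_aux : Real.cot 0 = 0 := by simp [Real.cot_eq_cos_div_sin]

theorem sum_cot_sq (a : ℕ) (ha : 0 < a) :
    ∑ i ∈ range a, Real.cot (π * i / a) ^ 2 = ((a : ℝ) - 1) * (a - 2) / 3 := by
  have ha' : (a : ℝ) ≠ 0 := by positivity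
  set f : ℕ → ℝ := fun i => π * i / a with hf
  have hf0 : f 0 = 0 := by simp [hf]
  have z1 : ∀ j : ℕ, ∑ i ∈ range a, Real.cot (f i - f j) = 0 := by
    intro j
    rw [← sum_cot_int a ha (-j)]
    refine Finset.sum_congr rfl fun i _ => ?_
    congr 1; simp only [hf]; push_cast; ring
  have z2 : ∑ i ∈ range a, Real.cot (f i) = 0 := by
    have := z1 0
    simpa [hf0] using this
  have pt : ∀ i ∈ range a, ∀ j ∈ range a,
      Real.cot (f i - f j) * Real.cot (f j) - Real.cot (f j) * Real.cot (f i)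
        + Real.cot (f i) * Real.cot (f j - f i)
      = 1 - (if j = 0 then 1 + Real.cot (f i) ^ 2 else 0)
          - (if i = 0 then 1 + Real.cot (f j) ^ 2 else 0)
          - (if i = j then 1 + Real.cot (f i) ^ 2 else 0)
          + (if i = 0 then (if j = 0 then 2 else 0) else 0) := by
    intro i hi j hj
    rw [mem_range] at hi hj
    have hneg : Real.cot (f j - f i) = - Real.cot (f i - f j) := by
      rw [← cot_neg_aux]; congr 1; ring
    by_cases h1 : i = 0
    · subst h1
      by_cases h2 : j = 0
      · subst h2; simp [hf0, cot_zero_aux]; norm_num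
      · simp [hf0, cot_zero_aux, h2, Ne.symm h2, cot_neg_aux]; ring
    · by_cases h2 : j = 0
      · subst h2; simp [hf0, cot_zero_aux, h1, cot_neg_aux]; ring
      · by_cases h3 : i = j
        · subst h3; simp [cot_zero_aux, h1]; ring
        · have s1 := sin_ne_aux2 a i j hi hj h3
          have s2 := sin_ne_aux2 a j 0 hj (by omega) h2
          have s3 := sin_ne_aux2 a 0 i (by omega) hi (Ne.symm h1)
          have := cot_three_aux _ _ _ (by ring) s1 s2 s3
          simp only [Nat.cast_zero, mul_zero, zero_div, sub_zero, zero_sub, cot_neg_aux] at this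
          change Real.cot (f i - f j) * Real.cot (f j) + Real.cot (f j) * -Real.cot (f i)
            + -Real.cot (f i) * Real.cot (f i - f j) = 1 at this
          simp [h1, h2, h3, hneg]
          linarith
  have tot := Finset.sum_congr rfl fun i hi => Finset.sum_congr rfl (pt i hi)
  have l1 : ∑ i ∈ range a, ∑ j ∈ range a, Real.cot (f i - f j) * Real.cot (f j) = 0 := by
    rw [Finset.sum_comm]; simp [← Finset.sum_mul, z1]
  have l2 : ∑ i ∈ range a, ∑ j ∈ range a, Real.cot (f j) * Real.cot (f i) = 0 := by
    simp [← Finset.sum_mul, z2]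
  have l3 : ∑ i ∈ range a, ∑ j ∈ range a, Real.cot (f i) * Real.cot (f j - f i) = 0 := by
    simp [← Finset.mul_sum, z1]
  simp only [Finset.sum_add_distrib, Finset.sum_sub_distrib, l1, l2, l3] at tot
  rw [Finset.sum_comm (f := fun i j => if i = 0 then 1 + Real.cot (f j) ^ 2 else 0)] at tot
  simp only [Finset.sum_ite_eq, Finset.sum_ite_eq', mem_range, ha, if_true,
    Finset.sum_const, card_range] at tot
  have e : ∑ x ∈ range a, (if x < a then 1 + Real.cot (f x) ^ 2 else 0)
      = ∑ x ∈ range a, (1 + Real.cot (f x) ^ 2) :=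
    Finset.sum_congr rfl fun x hx => by rw [if_pos (mem_range.mp hx)]
  have e2 : ∑ x ∈ range a, ∑ j ∈ range a, (if x = 0 then (if j = 0 then (2:ℝ) else 0) else 0)
      = 2 := by
    rw [Finset.sum_eq_single_of_mem 0 (by simpa using ha) (by intro b _ hb; simp [hb])]
    simp [ha]
  simp only [e, e2, Finset.sum_add_distrib, Finset.sum_const, card_range, nsmul_eq_mul] at tot
  linarith

/-- one of the three cyclic double sums -/
theorem triple_sum_aux (a b c : ℕ) (ha : 0 < a) (hb : 0 < b) (hc : 0 < c) :
    ∑ j ∈ range b, (∑ i ∈ range a, Real.cot (π * i / a - π * j / b)) *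
      (∑ k ∈ range c, Real.cot (π * j / b - π * k / c))
      = - (a * b * c * dedekindRademacherSum b c a) := by
  have hb' : (b : ℝ) ≠ 0 := by positivity
  unfold dedekindRademacherSum
  have h : ∀ j ∈ range b, (∑ i ∈ range a, Real.cot (π * i / a - π * j / b)) *
      (∑ k ∈ range c, Real.cot (π * j / b - π * k / c)) =
      - (a * c * (Real.cot (π * c * j / b) * Real.cot (π * a * j / b))) := by
    intro j _
    have h1 := sum_cot_aux a ha (-(π * j / b))
    have h2 := sum_cot_aux c hc (-(π * j / b))
    have e1 : ∑ i ∈ range a, Real.cot (π * i / a - π * j / b) =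
        - (a * Real.cot (π * a * j / b)) := by
      rw [← mul_neg, ← cot_neg_aux]
      convert h1 using 2
      · congr 1; ring
      · congr 1; ring
    have e2 : ∑ k ∈ range c, Real.cot (π * j / b - π * k / c) =
        c * Real.cot (π * c * j / b) := by
      have : c * Real.cot (π * c * j / b) = -(c * Real.cot (c * (-(π * j / b)))) := by
        rw [← mul_neg, ← cot_neg_aux]; congr 2; ring
      rw [this, ← h2, ← Finset.sum_neg_distrib]
      refine Finset.sum_congr rfl fun i _ => ?_
      rw [← cot_neg_aux]; congr 1; ring
    rw [e1, e2]; ring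
  rw [Finset.sum_congr rfl h, Finset.sum_neg_distrib, ← Finset.mul_sum,
    Finset.range_eq_Ico, Finset.sum_eq_sum_Ico_succ_bot hb]
  simp only [Nat.cast_zero, mul_zero, zero_div, cot_zero_aux, zero_add, Int.cast_natCast]
  field_simp

theorem dedekindRademacherSum_reciprocity (a b c : ℕ)
    (ha : 0 < a) (hb : 0 < b) (hc : 0 < c)
    (hab : Nat.Coprime a b) (hbc : Nat.Coprime b c) (hca : Nat.Coprime c a) :
    dedekindRademacherSum a b c + dedekindRademacherSum b c a +
        dedekindRademacherSum c a b =
      ((a : ℝ) ^ 2 + (b : ℝ) ^ 2 + (c : ℝ) ^ 2) / (3 * a * b * c) - 1 := by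
  have ha' : (a : ℝ) ≠ 0 := by positivity
  have hb' : (b : ℝ) ≠ 0 := by positivity
  have hc' : (c : ℝ) ≠ 0 := by positivity
  have T1 := triple_sum_aux a b c ha hb hc
  have T2 := triple_sum_aux b c a hb hc ha
  have T3 := triple_sum_aux c a b hc ha hb
  have S1 := sum_cot_sq a ha
  have S2 := sum_cot_sq b hb
  have S3 := sum_cot_sq c hc
  simp only [Finset.sum_mul_sum] at T1 T2 T3
  rw [Finset.sum_comm] at T1
  rw [Finset.sum_comm] at T2
  rw [Finset.sum_comm] at T3
  have T2' : ∑ i ∈ range a, ∑ j ∈ range b, ∑ k ∈ range c,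
      Real.cot (π * j / b - π * k / c) * Real.cot (π * k / c - π * i / a)
      = - (b * c * a * dedekindRademacherSum c a b) := by
    rw [← T2, Finset.sum_comm]
    refine Finset.sum_congr rfl fun j _ => ?_
    rw [Finset.sum_comm]
  have T3' : ∑ i ∈ range a, ∑ j ∈ range b, ∑ k ∈ range c,
      Real.cot (π * k / c - π * i / a) * Real.cot (π * i / a - π * j / b)
      = - (c * a * b * dedekindRademacherSum a b c) := by
    rw [← T3]
    symm
    rw [Finset.sum_comm]
    refine Finset.sum_congr rfl fun j _ => ?_
    rw [Finset.sum_comm]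
  have pt : ∀ i ∈ range a, ∀ j ∈ range b, ∀ k ∈ range c,
      Real.cot (π * i / a - π * j / b) * Real.cot (π * j / b - π * k / c)
      + Real.cot (π * j / b - π * k / c) * Real.cot (π * k / c - π * i / a)
      + Real.cot (π * k / c - π * i / a) * Real.cot (π * i / a - π * j / b)
      = 1 - (if j = 0 then 1 else 0) * (if k = 0 then 1 else 0) * (1 + Real.cot (π * i / a) ^ 2)
          - (if i = 0 then 1 else 0) * (if k = 0 then 1 else 0) * (1 + Real.cot (π * j / b) ^ 2)
          - (if i = 0 then 1 else 0) * (if j = 0 then 1 else 0) * (1 + Real.cot (π * k / c) ^ 2)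
          + (if i = 0 then 1 else 0) * (if j = 0 then 1 else 0) * (if k = 0 then 1 else 0) * 2 := by
    intro i hi j hj k hk
    rw [mem_range] at hi hj hk
    by_cases h1 : i = 0 ∧ j = 0
    · obtain ⟨rfl, rfl⟩ := h1
      by_cases h : k = 0
      · subst h; simp [cot_zero_aux]; norm_num
      · simp [cot_zero_aux, cot_neg_aux, h]; ring
    by_cases h2 : j = 0 ∧ k = 0
    · obtain ⟨rfl, rfl⟩ := h2
      have h : i ≠ 0 := by tauto
      simp [cot_zero_aux, cot_neg_aux, h]; ring
    by_cases h3 : k = 0 ∧ i = 0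
    · obtain ⟨rfl, rfl⟩ := h3
      have h : j ≠ 0 := by tauto
      simp [cot_zero_aux, cot_neg_aux, h]; ring
    rw [cot_three_aux _ _ _ (by ring) (sin_ne_aux a b i j hab hi hj h1)
      (sin_ne_aux b c j k hbc hj hk h2) (sin_ne_aux c a k i hca hk hi h3)]
    by_cases i0 : i = 0
    · have j0 : j ≠ 0 := by tauto
      have k0 : k ≠ 0 := by tauto
      simp [j0, k0]
    · by_cases j0 : j = 0
      · have k0 : k ≠ 0 := by tauto
        simp [i0, k0]
      · simp [i0, j0]
  have tot := Finset.sum_congr rfl fun i hi => Finset.sum_congr rfl fun j hj =>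
    Finset.sum_congr rfl (pt i hi j hj)
  simp only [Finset.sum_add_distrib, Finset.sum_sub_distrib, T1, T2', T3'] at tot
  simp only [← Finset.mul_sum, ← Finset.sum_mul, Finset.sum_ite_eq', mem_range, ha, hb, hc,
    if_true, Finset.sum_const, card_range, nsmul_eq_mul, Finset.sum_add_distrib,
    S1, S2, S3, one_mul, mul_one] at tot
  field_simp
  linarith
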